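/- Suppose ε satisfies βγ²μ/(4α₁βη² − αμ) < ε < (4α₁η² − ρ)/ρ, and the feedback amplifiers satisfy c₁⁻ < ξ₁ < c₁⁺ and c₂⁻ < ξ₂ < c₂⁺. Then the maximal decay rate σ_max = 1/(4ηL) is achieved: the energy of the closed-loop system satisfies E(t) ≤ 3·E(0)·e^{−t/(4ηL)} for all t > 0. -/

import Mathlib

/-- Partial derivative in the first (space) variable of `f = f x t`. -/
noncomputable def pdx (f : ℝ → ℝ → ℝ) (x t : ℝ) : ℝ := deriv (fun y => f y t) x

/-- Partial derivative in the second (time) variable of `f = f x t`. -/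
noncomputable def pdt (f : ℝ → ℝ → ℝ) (x t : ℝ) : ℝ := deriv (fun s => f x s) t

open Set MeasureTheory

section PartialDerivatives

variable {f : ℝ → ℝ → ℝ}

theorem hasDerivAt_section_fst_fderiv (hf : ContDiff ℝ 1 (Function.uncurry f)) (x t : ℝ) :
    HasDerivAt (fun y => f y t) (fderiv ℝ (Function.uncurry f) (x, t) (1, 0)) x := by
  have h := ((hf.differentiable one_ne_zero) (x, t)).hasFDerivAt
  exact h.comp_hasDerivAt x ((hasDerivAt_id x).prodMk (hasDerivAt_const x t))

theorem hasDerivAt_section_snd_fderiv (hf : ContDiff ℝ 1 (Function.uncurry f)) (x t : ℝ) :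
    HasDerivAt (fun s => f x s) (fderiv ℝ (Function.uncurry f) (x, t) (0, 1)) t := by
  have h := ((hf.differentiable one_ne_zero) (x, t)).hasFDerivAt
  exact h.comp_hasDerivAt t ((hasDerivAt_const t x).prodMk (hasDerivAt_id t))

theorem pdx_eq_fderiv (hf : ContDiff ℝ 1 (Function.uncurry f)) (x t : ℝ) :
    pdx f x t = fderiv ℝ (Function.uncurry f) (x, t) (1, 0) :=
  (hasDerivAt_section_fst_fderiv hf x t).deriv

theorem pdt_eq_fderiv (hf : ContDiff ℝ 1 (Function.uncurry f)) (x t : ℝ) :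
    pdt f x t = fderiv ℝ (Function.uncurry f) (x, t) (0, 1) :=
  (hasDerivAt_section_snd_fderiv hf x t).deriv

theorem hasDerivAt_pdx (hf : ContDiff ℝ 1 (Function.uncurry f)) (x t : ℝ) :
    HasDerivAt (fun y => f y t) (pdx f x t) x :=
  (hasDerivAt_section_fst_fderiv hf x t).differentiableAt.hasDerivAt

theorem hasDerivAt_pdt (hf : ContDiff ℝ 1 (Function.uncurry f)) (x t : ℝ) :
    HasDerivAt (fun s => f x s) (pdt f x t) t :=
  (hasDerivAt_section_snd_fderiv hf x t).differentiableAt.hasDerivAt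

theorem uncurry_pdx (hf : ContDiff ℝ 1 (Function.uncurry f)) :
    Function.uncurry (pdx f) = fun q => fderiv ℝ (Function.uncurry f) q (1, 0) :=
  funext fun q => pdx_eq_fderiv hf q.1 q.2

theorem uncurry_pdt (hf : ContDiff ℝ 1 (Function.uncurry f)) :
    Function.uncurry (pdt f) = fun q => fderiv ℝ (Function.uncurry f) q (0, 1) :=
  funext fun q => pdt_eq_fderiv hf q.1 q.2

theorem continuous_pdx (hf : ContDiff ℝ 1 (Function.uncurry f)) :
    Continuous (Function.uncurry (pdx f)) := by
  rw [uncurry_pdx hf]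
  exact (hf.continuous_fderiv one_ne_zero).clm_apply continuous_const

theorem continuous_pdt (hf : ContDiff ℝ 1 (Function.uncurry f)) :
    Continuous (Function.uncurry (pdt f)) := by
  rw [uncurry_pdt hf]
  exact (hf.continuous_fderiv one_ne_zero).clm_apply continuous_const

theorem contDiff_pdx (hf : ContDiff ℝ 2 (Function.uncurry f)) :
    ContDiff ℝ 1 (Function.uncurry (pdx f)) := by
  rw [uncurry_pdx (hf.of_le one_le_two)]
  exact (hf.fderiv_right (m := 1) (by norm_num)).clm_apply contDiff_const

theorem contDiff_pdt (hf : ContDiff ℝ 2 (Function.uncurry f)) :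
    ContDiff ℝ 1 (Function.uncurry (pdt f)) := by
  rw [uncurry_pdt (hf.of_le one_le_two)]
  exact (hf.fderiv_right (m := 1) (by norm_num)).clm_apply contDiff_const

/-- Mixed partial derivatives of a `C²` function commute. -/
theorem pdt_pdx_eq_pdx_pdt (hf : ContDiff ℝ 2 (Function.uncurry f)) (x t : ℝ) :
    pdt (pdx f) x t = pdx (pdt f) x t := by
  have hf1 : ContDiff ℝ 1 (Function.uncurry f) := hf.of_le one_le_two
  have hd : DifferentiableAt ℝ (fderiv ℝ (Function.uncurry f)) (x, t) :=
    (hf.fderiv_right (m := 1) (by norm_num)).differentiable one_ne_zero _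
  have hs := (hf.contDiffAt (x := (x, t))).isSymmSndFDerivAt (by simp)
  rw [pdt_eq_fderiv (contDiff_pdx hf), pdx_eq_fderiv (contDiff_pdt hf), uncurry_pdx hf1,
    uncurry_pdt hf1, fderiv_clm_apply hd (differentiableAt_const _),
    fderiv_clm_apply hd (differentiableAt_const _)]
  simpa using hs (0, 1) (1, 0)

/-- Differentiation under the integral sign for a `C¹` integrand. -/
theorem hasDerivAt_intervalIntegral_pdt (hf : ContDiff ℝ 1 (Function.uncurry f)) (a b t : ℝ) :
    HasDerivAt (fun s => ∫ x in a..b, f x s) (∫ x in a..b, pdt f x t) t := by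
  have hc := hf.continuous
  have hc' := continuous_pdt hf
  obtain ⟨C, hC⟩ := (isCompact_uIcc.prod (isCompact_closedBall t 1)).exists_bound_of_continuousOn
    (s := uIcc a b ×ˢ Metric.closedBall t 1) hc'.continuousOn
  have hsec (s : ℝ) : Continuous fun x => f x s := hc.comp (by fun_prop : Continuous fun x => (x, s))
  have hsec' (s : ℝ) : Continuous fun x => pdt f x s :=
    hc'.comp (by fun_prop : Continuous fun x => (x, s))
  refine (intervalIntegral.hasDerivAt_integral_of_dominated_loc_of_deriv_le
    (F := fun s x => f x s) (F' := fun s x => pdt f x s) (bound := fun _ => C)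
    (Metric.closedBall_mem_nhds t one_pos)
    (Filter.Eventually.of_forall fun s => (hsec s).aestronglyMeasurable)
    ((hsec t).intervalIntegrable _ _) (hsec' t).aestronglyMeasurable
    (Filter.Eventually.of_forall fun x hx s hs => hC (x, s) ⟨uIoc_subset_uIcc hx, hs⟩)
    intervalIntegrable_const
    (Filter.Eventually.of_forall fun x _ s _ => hasDerivAt_pdt hf x s)).2

/-- Integral form of a balance law `∂ₜ g = ∂ₓ h - r`. -/
theorem hasDerivAt_intervalIntegral_of_balance {g h : ℝ → ℝ → ℝ} {r : ℝ → ℝ} {a b t : ℝ}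
    (hab : a ≤ b) (hg : ContDiff ℝ 1 (Function.uncurry g)) (hh : ContDiff ℝ 1 (Function.uncurry h))
    (hr : Continuous r) (hbal : ∀ x ∈ Ioo a b, pdt g x t = pdx h x t - r x) :
    HasDerivAt (fun s => ∫ x in a..b, g x s) (h b t - h a t - ∫ x in a..b, r x) t := by
  have hi : IntervalIntegrable (fun x => pdx h x t) volume a b :=
    ((continuous_pdx hh).comp (by fun_prop : Continuous fun x => (x, t))).intervalIntegrable _ _
  have key : ∫ x in a..b, pdt g x t = h b t - h a t - ∫ x in a..b, r x := by
    rw [intervalIntegral.integral_congr_Ioo_of_le hab hbal,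
      intervalIntegral.integral_sub hi (hr.intervalIntegrable _ _),
      intervalIntegral.integral_eq_sub_of_hasDerivAt (fun x _ => hasDerivAt_pdx hh x t) hi]
  exact key ▸ hasDerivAt_intervalIntegral_pdt hg a b t

end PartialDerivatives

/-- A function with `V' ≤ -k V` on `(0, ∞)` decays exponentially. -/
theorem le_mul_exp_of_hasDerivAt_le {V V' : ℝ → ℝ} {k : ℝ} (hV : Continuous V)
    (hd : ∀ t > 0, HasDerivAt V (V' t) t) (hle : ∀ t > 0, V' t ≤ -k * V t) {t : ℝ} (ht : 0 < t) :
    V t ≤ V 0 * Real.exp (-(k * t)) := by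
  have hder : ∀ s > 0, HasDerivAt (fun s => V s * Real.exp (k * s))
      (V' s * Real.exp (k * s) + V s * (Real.exp (k * s) * k)) s := fun s hs =>
    (hd s hs).mul (((hasDerivAt_id s).const_mul k).exp.congr_deriv (by simp))
  have hanti : AntitoneOn (fun s => V s * Real.exp (k * s)) (Ici 0) := by
    refine antitoneOn_of_deriv_nonpos (convex_Ici 0) (by fun_prop) ?_ ?_
    · intro s hs
      rw [interior_Ici] at hs
      exact (hder s hs).differentiableAt.differentiableWithinAt
    · intro s hs
      rw [interior_Ici] at hs
      rw [(hder s hs).deriv]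
      nlinarith [mul_le_mul_of_nonneg_right (hle s hs) (Real.exp_pos (k * s)).le]
  have h := hanti (mem_Ici.2 le_rfl) (mem_Ici.2 ht.le) ht.le
  simp only [mul_zero, Real.exp_zero, mul_one] at h
  rwa [Real.exp_neg, ← div_eq_mul_inv, le_div_iff₀ (Real.exp_pos _)]

/-- A point strictly between the roots of `a x² - 2 b x + c` makes it negative. -/
theorem quadratic_neg_of_between_roots {a b D x : ℝ} (ha : 0 < a)
    (hlo : (b - Real.sqrt D) / a < x) (hhi : x < (b + Real.sqrt D) / a) :
    (a * x - b) ^ 2 < D := by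
  rw [div_lt_iff₀ ha] at hlo
  rw [lt_div_iff₀ ha] at hhi
  have h : |a * x - b| < Real.sqrt D := abs_lt.2 ⟨by linarith, by linarith⟩
  rw [Real.lt_sqrt (abs_nonneg _), sq_abs] at h
  exact h

theorem abs_mul_mul_le_of_sq_le {a b c s : ℝ} (ha : 0 ≤ a) (hb : 0 ≤ b) (hs : 0 ≤ s)
    (hc : c ^ 2 ≤ s ^ 2 * (a * b)) (y z : ℝ) :
    |c * y * z| ≤ s * ((a * y ^ 2 + b * z ^ 2) / 2) := by
  refine abs_le_of_sq_le_sq ?_ (by positivity)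
  have h1 := mul_le_mul_of_nonneg_right hc (by positivity : 0 ≤ y ^ 2 * z ^ 2)
  have h2 : 0 ≤ s ^ 2 * (a * y ^ 2 - b * z ^ 2) ^ 2 := by positivity
  nlinarith

/-- Pointwise bound of the multiplier density `ρ vₜ vₓ + μ pₜ pₓ` by the energy density, where
`y = vₜ`, `z = pₜ`, `u = vₓ` and `w = γ vₓ - pₓ`. -/
theorem abs_multiplier_le {ρ β μ α₁ γ η : ℝ} (hρ : 0 < ρ) (hβ : 0 < β) (hμ : 0 < μ)
    (hα₁ : 0 < α₁) (hη₁ : Real.sqrt (ρ / α₁) + Real.sqrt (μ * γ ^ 2 / α₁) ≤ η)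
    (hη₂ : Real.sqrt (μ / β) + Real.sqrt (μ * γ ^ 2 / α₁) ≤ η) (y z u w : ℝ) :
    |ρ * y * u + μ * z * (γ * u - w)| ≤
      η * ((ρ * y ^ 2 + μ * z ^ 2 + α₁ * u ^ 2 + β * w ^ 2) / 2) := by
  have h1 := abs_mul_mul_le_of_sq_le hρ.le hα₁.le (Real.sqrt_nonneg (ρ / α₁)) (c := ρ)
    (by rw [Real.sq_sqrt (by positivity)]; apply le_of_eq; field_simp) y u
  have h2 := abs_mul_mul_le_of_sq_le hμ.le hα₁.le (Real.sqrt_nonneg (μ * γ ^ 2 / α₁))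
    (c := μ * γ) (by rw [Real.sq_sqrt (by positivity)]; apply le_of_eq; field_simp) z u
  have h3 := abs_mul_mul_le_of_sq_le hμ.le hβ.le (Real.sqrt_nonneg (μ / β)) (c := μ)
    (by rw [Real.sq_sqrt (by positivity)]; apply le_of_eq; field_simp) z w
  have n1 := Real.sqrt_nonneg (ρ / α₁)
  have n2 := Real.sqrt_nonneg (μ * γ ^ 2 / α₁)
  have n3 := Real.sqrt_nonneg (μ / β)
  generalize Real.sqrt (ρ / α₁) = a at *
  generalize Real.sqrt (μ * γ ^ 2 / α₁) = b at *
  generalize Real.sqrt (μ / β) = c at *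
  have k1 : 0 ≤ (η - a) * (ρ * y ^ 2) := mul_nonneg (by linarith) (by positivity)
  have k2 : 0 ≤ (η - (a + b)) * (α₁ * u ^ 2) := mul_nonneg (by linarith) (by positivity)
  have k3 : 0 ≤ (η - (c + b)) * (μ * z ^ 2) := mul_nonneg (by linarith) (by positivity)
  have k4 : 0 ≤ (η - c) * (β * w ^ 2) := mul_nonneg (by linarith) (by positivity)
  rw [abs_le] at *
  constructor <;> linarith [h1.1, h1.2, h2.1, h2.2, h3.1, h3.2]

/-- The boundary energy density at the controlled end is absorbed by the boundary damping,
with `y = vₜ`, `z = pₜ`, `u = vₓ` and `w = γ vₓ - pₓ`. -/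
theorem boundary_energy_le {ρ β μ α₁ α γ η ε ξ₁ ξ₂ : ℝ} (hβ : 0 < β) (hα₁ : 0 < α₁)
    (hα : α = α₁ + γ ^ 2 * β) (hε : 0 < ε)
    (hξ₁ : ((1 + ε) * ξ₁ - 2 * α₁ * η) ^ 2 < 4 * α₁ ^ 2 * η ^ 2 - (1 + ε) * ρ * α₁)
    (hξ₂ : ((ε * α + β * γ ^ 2) * ξ₂ - 2 * ε * α₁ * β * η) ^ 2 <
      4 * (ε * α₁ * β * η) ^ 2 - (ε * α + β * γ ^ 2) * ε * μ * α₁ * β)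
    {y z u w : ℝ} (hu : α₁ * u = -(ξ₁ * y + γ * ξ₂ * z)) (hw : β * w = ξ₂ * z) :
    ρ * y ^ 2 + μ * z ^ 2 + α₁ * u ^ 2 + β * w ^ 2 ≤ 4 * η * (ξ₁ * y ^ 2 + ξ₂ * z ^ 2) := by
  have hc : 0 < ε * α + β * γ ^ 2 := by rw [hα]; positivity
  have q1 : (1 + ε) * ξ₁ ^ 2 - 4 * α₁ * η * ξ₁ + ρ * α₁ < 0 :=
    neg_of_mul_neg_right (a := 1 + ε) (by linarith) (by linarith)
  have q2 : (ε * α + β * γ ^ 2) * ξ₂ ^ 2 - 4 * ε * α₁ * β * η * ξ₂ + ε * μ * α₁ * β < 0 :=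
    neg_of_mul_neg_right (a := ε * α + β * γ ^ 2) (by linarith) hc.le
  have e1 : ε * β * α₁ * (α₁ * u ^ 2) = ε * β * (ξ₁ * y + γ * ξ₂ * z) ^ 2 := by
    linear_combination ε * β * (α₁ * u - (ξ₁ * y + γ * ξ₂ * z)) * hu
  have e2 : ε * β * α₁ * (β * w ^ 2) = ε * α₁ * (ξ₂ * z) ^ 2 := by
    linear_combination ε * α₁ * (β * w + ξ₂ * z) * hw
  have k0 : 0 ≤ β * (ε * ξ₁ * y - γ * ξ₂ * z) ^ 2 := by positivity
  have k1 := mul_nonneg (by positivity : 0 ≤ ε * β * y ^ 2) (neg_nonneg.2 q1.le)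
  have k2 := mul_nonneg (by positivity : 0 ≤ z ^ 2) (neg_nonneg.2 q2.le)
  refine le_of_mul_le_mul_left ?_ (by positivity : 0 < ε * β * α₁)
  subst hα
  linarith

set_option maxHeartbeats 1000000 in
/-- If `ε` lies in the admissible interval and the feedback amplifiers satisfy
`c₁⁻ < ξ₁ < c₁⁺` and `c₂⁻ < ξ₂ < c₂⁺`, then the maximal decay rate `σ_max = 1/(4ηL)` is
achieved: `E(t) ≤ 3 E(0) e^{−t/(4ηL)}` for all `t > 0`. -/
theorem maximal_decay_rate_achieved
    (ρ β μ α₁ L γ : ℝ) (hρ : 0 < ρ) (hβ : 0 < β) (hμ : 0 < μ) (hα₁ : 0 < α₁) (hL : 0 < L)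
    (α : ℝ) (hα : α = α₁ + γ ^ 2 * β)
    (η : ℝ)
    (hη : η = max (Real.sqrt (ρ / α₁) + Real.sqrt (μ * γ ^ 2 / α₁))
                  (Real.sqrt (μ / β) + Real.sqrt (μ * γ ^ 2 / α₁)))
    (ξ₁ ξ₂ : ℝ) (hξ₁ : 0 < ξ₁) (hξ₂ : 0 < ξ₂)
    (v p : ℝ → ℝ → ℝ)
    (hv : ContDiff ℝ 2 (Function.uncurry v)) (hp : ContDiff ℝ 2 (Function.uncurry p))
    (heq1 : ∀ x ∈ Set.Ioo (0:ℝ) L, ∀ t > (0:ℝ),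
      ρ * pdt (pdt v) x t = α * pdx (pdx v) x t - γ * β * pdx (pdx p) x t)
    (heq2 : ∀ x ∈ Set.Ioo (0:ℝ) L, ∀ t > (0:ℝ),
      μ * pdt (pdt p) x t = -(γ * β) * pdx (pdx v) x t + β * pdx (pdx p) x t)
    (hbc0 : ∀ t > (0:ℝ), v 0 t = 0 ∧ p 0 t = 0)
    (hbc1 : ∀ t > (0:ℝ), α * pdx v L t - γ * β * pdx p L t = -ξ₁ * pdt v L t)
    (hbc2 : ∀ t > (0:ℝ), -(γ * β) * pdx v L t + β * pdx p L t = -ξ₂ * pdt p L t)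
    (E : ℝ → ℝ)
    (hE : ∀ t, E t = (1 / 2) * ∫ x in (0:ℝ)..L,
        ρ * (pdt v x t) ^ 2 + μ * (pdt p x t) ^ 2 + α₁ * (pdx v x t) ^ 2
          + β * (γ * pdx v x t - pdx p x t) ^ 2)
    (ε : ℝ)
    (hε₁ : β * γ ^ 2 * μ / (4 * α₁ * β * η ^ 2 - α * μ) < ε)
    (hε₂ : ε < (4 * α₁ * η ^ 2 - ρ) / ρ)
    (hξ₁lo : (2 * α₁ * η - Real.sqrt (4 * α₁ ^ 2 * η ^ 2 - (1 + ε) * ρ * α₁)) / (1 + ε) < ξ₁)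
    (hξ₁hi : ξ₁ < (2 * α₁ * η + Real.sqrt (4 * α₁ ^ 2 * η ^ 2 - (1 + ε) * ρ * α₁)) / (1 + ε))
    (hξ₂lo : (2 * ε * α₁ * β * η -
        Real.sqrt (4 * (ε * α₁ * β * η) ^ 2 - (ε * α + β * γ ^ 2) * ε * μ * α₁ * β)) /
        (ε * α + β * γ ^ 2) < ξ₂)
    (hξ₂hi : ξ₂ < (2 * ε * α₁ * β * η +
        Real.sqrt (4 * (ε * α₁ * β * η) ^ 2 - (ε * α + β * γ ^ 2) * ε * μ * α₁ * β)) /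
        (ε * α + β * γ ^ 2))
    : ∀ t > (0:ℝ), E t ≤ 3 * E 0 * Real.exp (-(t / (4 * η * L))) := by
  have hη₁ : Real.sqrt (ρ / α₁) + Real.sqrt (μ * γ ^ 2 / α₁) ≤ η := hη ▸ le_max_left _ _
  have hη₂ : Real.sqrt (μ / β) + Real.sqrt (μ * γ ^ 2 / α₁) ≤ η := hη ▸ le_max_right _ _
  have hη0 : 0 < η := lt_of_lt_of_le
    (add_pos_of_pos_of_nonneg (Real.sqrt_pos.2 (by positivity)) (Real.sqrt_nonneg _)) hη₁
  have hε : 0 < ε := by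
    have h1 : μ / β + μ * γ ^ 2 / α₁ ≤ η ^ 2 := by
      have a1 := Real.sq_sqrt (by positivity : 0 ≤ μ / β)
      have a2 := Real.sq_sqrt (by positivity : 0 ≤ μ * γ ^ 2 / α₁)
      have a3 := mul_nonneg (Real.sqrt_nonneg (μ / β)) (Real.sqrt_nonneg (μ * γ ^ 2 / α₁))
      have a4 := pow_le_pow_left₀
        (add_nonneg (Real.sqrt_nonneg (μ / β)) (Real.sqrt_nonneg (μ * γ ^ 2 / α₁))) hη₂ 2
      linarith
    have h2 : α * μ ≤ α₁ * β * η ^ 2 := by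
      calc α * μ = α₁ * β * (μ / β + μ * γ ^ 2 / α₁) := by rw [hα]; field_simp
        _ ≤ _ := by gcongr
    have h3 : 0 < α₁ * β * η ^ 2 := by positivity
    exact lt_of_le_of_lt (div_nonneg (by positivity) (by linarith)) hε₁
  have hq1 := quadratic_neg_of_between_roots (by linarith) hξ₁lo hξ₁hi
  have hq2 := quadratic_neg_of_between_roots (by rw [hα]; positivity) hξ₂lo hξ₂hi
  have hvx := contDiff_pdx hv
  have hvt := contDiff_pdt hv
  have hpx := contDiff_pdx hp
  have hpt := contDiff_pdt hp
  set δ : ℝ := 1 / (2 * η * L) with hδ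
  have hδ0 : 0 < δ := by positivity
  set e : ℝ → ℝ → ℝ := fun x t => 1 / 2 * (ρ * pdt v x t ^ 2 + μ * pdt p x t ^ 2 +
    α₁ * pdx v x t ^ 2 + β * (γ * pdx v x t - pdx p x t) ^ 2) with he
  set m : ℝ → ℝ → ℝ := fun x t =>
    ρ * pdt v x t * pdx v x t + μ * pdt p x t * pdx p x t with hm
  set g : ℝ → ℝ → ℝ := fun x t => e x t + δ * x * m x t with hg
  set h : ℝ → ℝ → ℝ := fun x t => pdt v x t * (α * pdx v x t - γ * β * pdx p x t) +
    pdt p x t * (-(γ * β) * pdx v x t + β * pdx p x t) + δ * x * e x t with hh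
  have hvx' : ContDiff ℝ 1 fun q : ℝ × ℝ => pdx v q.1 q.2 := hvx
  have hvt' : ContDiff ℝ 1 fun q : ℝ × ℝ => pdt v q.1 q.2 := hvt
  have hpx' : ContDiff ℝ 1 fun q : ℝ × ℝ => pdx p q.1 q.2 := hpx
  have hpt' : ContDiff ℝ 1 fun q : ℝ × ℝ => pdt p q.1 q.2 := hpt
  have hec : ContDiff ℝ 1 (Function.uncurry e) := by
    simp only [he, Function.uncurry_def]; fun_prop
  have hgc : ContDiff ℝ 1 (Function.uncurry g) := by
    simp only [hg, he, hm, Function.uncurry_def]; fun_prop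
  have hhc : ContDiff ℝ 1 (Function.uncurry h) := by
    simp only [hh, he, Function.uncurry_def]; fun_prop
  have hEe (t : ℝ) : E t = ∫ x in (0:ℝ)..L, e x t := by
    rw [hE, ← intervalIntegral.integral_const_mul]
  have hbal : ∀ t > 0, ∀ x ∈ Ioo 0 L, pdt g x t = pdx h x t - δ * e x t := by
    intro t ht x hx
    have a1 := hasDerivAt_pdt hvx x t
    have a2 := hasDerivAt_pdt hvt x t
    have a3 := hasDerivAt_pdt hpx x t
    have a4 := hasDerivAt_pdt hpt x t
    have b1 := hasDerivAt_pdx hvx x t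
    have b2 := hasDerivAt_pdx hvt x t
    have b3 := hasDerivAt_pdx hpx x t
    have b4 := hasDerivAt_pdx hpt x t
    rw [pdt_pdx_eq_pdx_pdt hv] at a1
    rw [pdt_pdx_eq_pdx_pdt hp] at a3
    have de := (((((a2.pow 2).const_mul ρ).add ((a4.pow 2).const_mul μ)).add
      ((a1.pow 2).const_mul α₁)).add ((((a1.const_mul γ).sub a3).pow 2).const_mul β)).const_mul
        (1 / 2)
    have dm := ((a2.const_mul ρ).mul a1).add ((a4.const_mul μ).mul a3)
    have de' := (((((b2.pow 2).const_mul ρ).add ((b4.pow 2).const_mul μ)).add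
      ((b1.pow 2).const_mul α₁)).add ((((b1.const_mul γ).sub b3).pow 2).const_mul β)).const_mul
        (1 / 2)
    have dg := (de.add (dm.const_mul (δ * x))).deriv
    have dh := (((b2.mul ((b1.const_mul α).sub (b3.const_mul (γ * β)))).add
      (b4.mul ((b1.const_mul (-(γ * β))).add (b3.const_mul β)))).add
      (((hasDerivAt_id x).const_mul δ).mul de')).deriv
    have dg' : pdt g x t = _ := dg
    have dh' : pdx h x t = _ := dh
    rw [dg', dh']
    simp only [he, Pi.add_apply, Pi.pow_apply, Pi.sub_apply, id]
    have q1 := heq1 x hx t ht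
    have q2 := heq2 x hx t ht
    rw [hα] at q1 ⊢
    norm_num
    linear_combination (pdt v x t + δ * x * pdx v x t) * q1 +
      (pdt p x t + δ * x * pdx p x t) * q2
  have hder : ∀ t > 0, HasDerivAt (fun s => ∫ x in (0:ℝ)..L, g x s)
      (h L t - h 0 t - δ * E t) t := by
    intro t ht
    have hr : Continuous fun x => δ * e x t :=
      continuous_const.mul (hec.continuous.comp (by fun_prop : Continuous fun x => (x, t)))
    have := hasDerivAt_intervalIntegral_of_balance hL.le hgc hhc hr (hbal t ht)
    rwa [intervalIntegral.integral_const_mul, ← hEe] at this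
  have hh0 : ∀ t > 0, h 0 t = 0 := by
    intro t ht
    have hz : ∀ f : ℝ → ℝ → ℝ, (∀ s > 0, f 0 s = 0) → pdt f 0 t = 0 := fun f hf =>
      ((Filter.eventuallyEq_of_mem (Ioi_mem_nhds ht) hf).deriv_eq).trans (deriv_const t 0)
    simp [hh, hz v fun s hs => (hbc0 s hs).1, hz p fun s hs => (hbc0 s hs).2]
  have hhL : ∀ t > 0, h L t ≤ 0 := by
    intro t ht
    have c1 := hbc1 t ht
    have c2 := hbc2 t ht
    have hb := boundary_energy_le hβ hα₁ hα hε hq1 hq2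
      (y := pdt v L t) (z := pdt p L t) (u := pdx v L t) (w := γ * pdx v L t - pdx p L t)
      (by rw [hα] at c1; linear_combination c1 + γ * c2) (by linear_combination -c2)
    have hb' := mul_le_mul_of_nonneg_left hb (by positivity : 0 ≤ 1 / (4 * η))
    have hδL : δ * L = 1 / (2 * η) := by rw [hδ]; field_simp
    simp only [hh, he]
    rw [c1, c2, hδL]
    have e1 : 1 / (4 * η) * (4 * η * (ξ₁ * pdt v L t ^ 2 + ξ₂ * pdt p L t ^ 2)) =
        ξ₁ * pdt v L t ^ 2 + ξ₂ * pdt p L t ^ 2 := by field_simp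
    have e2 : 1 / (2 * η) = 2 * (1 / (4 * η)) := by field_simp; norm_num
    rw [e1] at hb'
    rw [e2]
    linarith
  have hpt_le : ∀ t, ∀ x ∈ Icc 0 L, 1 / 2 * e x t ≤ g x t ∧ g x t ≤ 3 / 2 * e x t := by
    intro t x hx
    have hmul := abs_multiplier_le hρ hβ hμ hα₁ hη₁ hη₂ (pdt v x t) (pdt p x t) (pdx v x t)
      (γ * pdx v x t - pdx p x t)
    rw [sub_sub_cancel] at hmul
    have hm_le : |m x t| ≤ η * e x t := hmul.trans_eq (by simp only [he]; ring)
    have hbd : |δ * x * m x t| ≤ 1 / 2 * e x t := by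
      rw [abs_mul, abs_of_nonneg (mul_nonneg hδ0.le hx.1)]
      calc δ * x * |m x t| ≤ δ * L * (η * e x t) := by
            gcongr
            exact hx.2
        _ = 1 / 2 * e x t := by rw [hδ]; field_simp
    obtain ⟨l, r⟩ := abs_le.1 hbd
    constructor <;> simp only [hg] <;> linarith
  have hgi (t : ℝ) : IntervalIntegrable (fun x => g x t) volume 0 L :=
    (hgc.continuous.comp (by fun_prop : Continuous fun x => (x, t))).intervalIntegrable _ _
  have hei (t : ℝ) (c : ℝ) : IntervalIntegrable (fun x => c * e x t) volume 0 L :=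
    (continuous_const.mul
      (hec.continuous.comp (by fun_prop : Continuous fun x => (x, t)))).intervalIntegrable _ _
  have hlow (t : ℝ) : 1 / 2 * E t ≤ ∫ x in (0:ℝ)..L, g x t := by
    rw [hEe, ← intervalIntegral.integral_const_mul]
    exact intervalIntegral.integral_mono_on hL.le (hei t _) (hgi t) fun x hx => (hpt_le t x hx).1
  have hupp (t : ℝ) : ∫ x in (0:ℝ)..L, g x t ≤ 3 / 2 * E t := by
    rw [hEe, ← intervalIntegral.integral_const_mul]
    exact intervalIntegral.integral_mono_on hL.le (hgi t) (hei t _) fun x hx => (hpt_le t x hx).2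
  have hE0 (t : ℝ) : 0 ≤ E t := by
    rw [hEe]
    exact intervalIntegral.integral_nonneg hL.le fun x _ => by simp only [he]; positivity
  intro t ht
  have hdecay := le_mul_exp_of_hasDerivAt_le (k := 1 / (4 * η * L))
    (continuous_iff_continuousAt.2 fun s =>
      (hasDerivAt_intervalIntegral_pdt hgc 0 L s).continuousAt) hder (fun s hs => by
      have hk : δ = 2 * (1 / (4 * η * L)) := by rw [hδ]; field_simp; norm_num
      have hk0 : 0 < 1 / (4 * η * L) := by positivity
      have := mul_le_mul_of_nonneg_left (hupp s) hk0.le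
      have hkE := mul_nonneg hk0.le (hE0 s)
      rw [hh0 s hs, hk]
      linarith [hhL s hs]) ht
  rw [one_div_mul_eq_div] at hdecay
  have := mul_le_mul_of_nonneg_right (hupp 0) (Real.exp_pos (-(t / (4 * η * L)))).le
  linarith [hlow t]
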